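/- arXiv:2305.08570 — 5 statements merged into one kernel-verified Lean document; each statement's English description precedes it below -/
import Mathlib

section
/- Let n ≥ 3 be an integer, r₀ > 0 and H₀ > 0 real numbers, and set m₀ = (r₀^(n−2)/2)·(1 − r₀²H₀²/(n−1)²). Define u : [0, ∞) → ℝ by u(t) = r₀·e^(t/(n−1)) / ((n−1)·√(1 − 2·m₀·r₀^(2−n)·e^(−(n−2)t/(n−1)))). Then for every t ≥ 0 one has 1 − 2·m₀·r₀^(2−n)·e^(−(n−2)t/(n−1)) > 0 (so u is well defined and positive), u(0) = H₀⁻¹, and u is differentiable at t with u′(t) = (n/(2(n−1)))·u(t) − ((n−1)(n−2)/(2r₀²))·e^(−2t/(n−1))·u(t)³. -/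
/-- For `a ≠ 0`, the function `r e^(t/a) / (a √(1 - K e^(-(a-1)t/a)))` satisfies
`u′ = ((a+1)/(2a)) u - (a(a-1)/(2r²)) e^(-2t/a) u³` wherever the radicand is positive. -/
theorem hasDerivAt_exp_div_sqrt_one_sub_exp {a r K t : ℝ} (ha : a ≠ 0) (hr : r ≠ 0)
    (hf : 0 < 1 - K * Real.exp (-(a - 1) * t / a)) :
    HasDerivAt
      (fun t ↦ r * Real.exp (t / a) / (a * Real.sqrt (1 - K * Real.exp (-(a - 1) * t / a))))
      ((a + 1) / (2 * a) *
          (r * Real.exp (t / a) / (a * Real.sqrt (1 - K * Real.exp (-(a - 1) * t / a))))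
        - a * (a - 1) / (2 * r ^ 2) * Real.exp (-2 * t / a) *
          (r * Real.exp (t / a) / (a * Real.sqrt (1 - K * Real.exp (-(a - 1) * t / a)))) ^ 3) t := by
  have hX : HasDerivAt (fun t ↦ r * Real.exp (t / a)) (r * (Real.exp (t / a) * (1 / a))) t :=
    (((hasDerivAt_id t).div_const a).exp).const_mul r
  have hE : HasDerivAt (fun t ↦ 1 - K * Real.exp (-(a - 1) * t / a))
      (-(K * (Real.exp (-(a - 1) * t / a) * (-(a - 1) * 1 / a)))) t :=
    (((((hasDerivAt_id t).const_mul (-(a - 1))).div_const a).exp).const_mul K).const_sub 1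
  have hs := Real.sqrt_pos.2 hf
  have hs2 := Real.sq_sqrt hf.le
  have hexp : Real.exp (-2 * t / a) = (Real.exp (t / a) ^ 2)⁻¹ := by
    rw [← Real.exp_nat_mul, ← Real.exp_neg]
    congr 1
    push_cast
    ring
  refine (hX.div ((hE.sqrt hf.ne').const_mul a) (mul_ne_zero ha hs.ne')).congr_deriv ?_
  rw [hexp]
  have hX0 := (Real.exp_pos (t / a)).ne'
  generalize Real.exp (t / a) = X at *
  have hKE : K * Real.exp (-(a - 1) * t / a)
      = 1 - Real.sqrt (1 - K * Real.exp (-(a - 1) * t / a)) ^ 2 := by rw [hs2]; ring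
  generalize Real.sqrt (1 - K * Real.exp (-(a - 1) * t / a)) = s at *
  rw [← mul_assoc K, hKE]
  have hs0 := hs.ne'
  field_simp
  ring

/-- The explicit function
`u(t) = r₀ e^(t/(n−1)) / ((n−1)√(1 − 2 m₀ r₀^(2−n) e^(−(n−2)t/(n−1))))`,
with `m₀ = (r₀^(n−2)/2)(1 − r₀²H₀²/(n−1)²)`, is well defined and positive on `[0, ∞)`,
satisfies `u(0) = H₀⁻¹`, and solves the IMCF speed equation
`u′(t) = (n/(2(n−1)))u − ((n−1)(n−2)/(2r₀²))e^(−2t/(n−1))u³`. -/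
theorem imcf_speed_ode_explicit_solution
    (n : ℕ) (hn : 3 ≤ n) (r₀ H₀ : ℝ) (hr₀ : 0 < r₀) (hH₀ : 0 < H₀)
    (m₀ : ℝ)
    (hm₀ : m₀ = r₀ ^ ((n : ℝ) - 2) / 2 * (1 - r₀ ^ 2 * H₀ ^ 2 / ((n : ℝ) - 1) ^ 2))
    (u : ℝ → ℝ)
    (hu : ∀ t, u t = r₀ * Real.exp (t / ((n : ℝ) - 1)) /
      (((n : ℝ) - 1) *
        Real.sqrt (1 - 2 * m₀ * r₀ ^ ((2 : ℝ) - n)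
          * Real.exp (-((n : ℝ) - 2) * t / ((n : ℝ) - 1))))) :
    ∀ t, 0 ≤ t →
      0 < 1 - 2 * m₀ * r₀ ^ ((2 : ℝ) - n)
            * Real.exp (-((n : ℝ) - 2) * t / ((n : ℝ) - 1)) ∧
      (0 < u t ∧ u 0 = H₀⁻¹) ∧
      HasDerivWithinAt u
        ((n : ℝ) / (2 * ((n : ℝ) - 1)) * u t
          - ((n : ℝ) - 1) * ((n : ℝ) - 2) / (2 * r₀ ^ 2)
              * Real.exp (-2 * t / ((n : ℝ) - 1)) * u t ^ 3)
        (Set.Ici 0) t := by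
  have hn' : (3 : ℝ) ≤ n := by exact_mod_cast hn
  have ha : 0 < (n : ℝ) - 1 := by linarith
  have hK : 2 * m₀ * r₀ ^ ((2 : ℝ) - n) = 1 - r₀ ^ 2 * H₀ ^ 2 / ((n : ℝ) - 1) ^ 2 := by
    have h : r₀ ^ ((n : ℝ) - 2) * r₀ ^ ((2 : ℝ) - n) = 1 := by
      rw [← Real.rpow_add hr₀]
      simp
    rw [hm₀]
    linear_combination (1 - r₀ ^ 2 * H₀ ^ 2 / ((n : ℝ) - 1) ^ 2) * h
  intro t ht
  have hf : 0 < 1 - 2 * m₀ * r₀ ^ ((2 : ℝ) - n)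
      * Real.exp (-((n : ℝ) - 2) * t / ((n : ℝ) - 1)) := by
    have hE : Real.exp (-((n : ℝ) - 2) * t / ((n : ℝ) - 1)) ≤ 1 := by
      refine Real.exp_le_one_iff.2 (div_nonpos_of_nonpos_of_nonneg ?_ ha.le)
      nlinarith
    have hpos : 0 < r₀ ^ 2 * H₀ ^ 2 / ((n : ℝ) - 1) ^ 2
        * Real.exp (-((n : ℝ) - 2) * t / ((n : ℝ) - 1)) := by positivity
    rw [hK]
    linarith
  refine ⟨hf, ⟨?_, ?_⟩, ?_⟩
  · rw [hu]
    have := Real.sqrt_pos.2 hf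
    positivity
  · have hsq : Real.sqrt (r₀ ^ 2 * H₀ ^ 2 / ((n : ℝ) - 1) ^ 2) = r₀ * H₀ / ((n : ℝ) - 1) := by
      rw [← mul_pow, ← div_pow, Real.sqrt_sq (by positivity)]
    rw [hu, hK]
    simp only [mul_zero, zero_div, Real.exp_zero, mul_one, sub_sub_cancel, hsq]
    field_simp
  · have hn2 : (n : ℝ) - 2 = (n : ℝ) - 1 - 1 := by ring
    rw [hn2] at hf
    have h := hasDerivAt_exp_div_sqrt_one_sub_exp ha.ne' hr₀.ne' hf
    simp only [← hn2, ← hu, sub_add_cancel] at h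
    exact h.hasDerivWithinAt
end

section
/- Let n ≥ 3 be an integer, r₀ > 0 and H₀ > 0 real numbers, and set m₀ = (r₀^(n−2)/2)·(1 − r₀²H₀²/(n−1)²). Let T ∈ (0, ∞]. Suppose v : [0, T) → ℝ satisfies v(t) > 0 for all t ∈ [0, T), v(0) = H₀⁻¹, and v is differentiable at every t ∈ [0, T) with v′(t) = (n/(2(n−1)))·v(t) − ((n−1)(n−2)/(2r₀²))·e^(−2t/(n−1))·v(t)³. Then v(t) = r₀·e^(t/(n−1)) / ((n−1)·√(1 − 2·m₀·r₀^(2−n)·e^(−(n−2)t/(n−1)))) for all t ∈ [0, T). -/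
/-- First integral of the Bernoulli equation
`v′ = ((N + 1) / (2N)) v − (N (N − 1) / (2r²)) e^(−2t/N) v³`. -/
lemma hasDerivWithinAt_bernoulli_first_integral {N r t : ℝ} {v : ℝ → ℝ} {s : Set ℝ}
    (hN : N ≠ 0) (hr : r ≠ 0) (hv : v t ≠ 0)
    (h : HasDerivWithinAt v
      ((N + 1) / (2 * N) * v t
        - N * (N - 1) / (2 * r ^ 2) * Real.exp (-2 * t / N) * v t ^ 3) s t) :
    HasDerivWithinAt
      (fun u => (v u ^ 2)⁻¹ * Real.exp ((N + 1) * u / N)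
        - N ^ 2 / r ^ 2 * Real.exp ((N - 1) * u / N)) 0 s t := by
  have hexp (c : ℝ) : HasDerivWithinAt (fun u => Real.exp (c * u / N))
      (Real.exp (c * t / N) * (c * 1 / N)) s t :=
    (((hasDerivWithinAt_id t s).const_mul c).div_const N).exp
  have hE : Real.exp ((N - 1) * t / N)
      = Real.exp (-2 * t / N) * Real.exp ((N + 1) * t / N) := by
    rw [← Real.exp_add]
    congr 1
    ring
  refine ((((h.fun_pow 2).fun_inv (pow_ne_zero 2 hv)).fun_mul (hexp (N + 1))).fun_sub
    ((hexp (N - 1)).const_mul (N ^ 2 / r ^ 2))).congr_deriv ?_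
  rw [hE]
  field_simp
  ring

/-- A function with vanishing derivative on `[0, t]` takes the same value at both ends. -/
lemma eq_of_hasDerivWithinAt_zero_Icc {f : ℝ → ℝ} {t : ℝ} (ht : 0 ≤ t)
    (h : ∀ u ∈ Set.Icc 0 t, HasDerivWithinAt f 0 (Set.Icc 0 t) u) : f t = f 0 := by
  have := (convex_Icc 0 t).norm_image_sub_le_of_norm_hasDerivWithin_le (C := 0) h
    (by simp) (Set.left_mem_Icc.2 ht) (Set.right_mem_Icc.2 ht)
  rw [zero_mul, norm_le_zero_iff, sub_eq_zero] at this
  exact this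

/-- Uniqueness for the IMCF speed equation: any positive solution `v` on `[0, T)`
(`T ∈ (0, ∞]`) of `v′(t) = (n/(2(n−1)))v − ((n−1)(n−2)/(2r₀²))e^(−2t/(n−1))v³`
with `v(0) = H₀⁻¹` equals the explicit Schwarzschild solution
`r₀ e^(t/(n−1)) / ((n−1)√(1 − 2 m₀ r₀^(2−n) e^(−(n−2)t/(n−1))))`,
where `m₀ = (r₀^(n−2)/2)(1 − r₀²H₀²/(n−1)²)`. -/
theorem imcf_speed_ode_unique
    (n : ℕ) (hn : 3 ≤ n) (r₀ H₀ : ℝ) (hr₀ : 0 < r₀) (hH₀ : 0 < H₀)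
    (m₀ : ℝ)
    (hm₀ : m₀ = r₀ ^ ((n : ℝ) - 2) / 2 * (1 - r₀ ^ 2 * H₀ ^ 2 / ((n : ℝ) - 1) ^ 2))
    (T : EReal) (hT : 0 < T)
    (v : ℝ → ℝ)
    (hvpos : ∀ t : ℝ, 0 ≤ t → (t : EReal) < T → 0 < v t)
    (hv0 : v 0 = H₀⁻¹)
    (hvderiv : ∀ t : ℝ, 0 ≤ t → (t : EReal) < T →
      HasDerivWithinAt v
        ((n : ℝ) / (2 * ((n : ℝ) - 1)) * v t
          - ((n : ℝ) - 1) * ((n : ℝ) - 2) / (2 * r₀ ^ 2)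
              * Real.exp (-2 * t / ((n : ℝ) - 1)) * v t ^ 3)
        {s : ℝ | 0 ≤ s ∧ (s : EReal) < T} t) :
    ∀ t : ℝ, 0 ≤ t → (t : EReal) < T →
      v t = r₀ * Real.exp (t / ((n : ℝ) - 1)) /
        (((n : ℝ) - 1) *
          Real.sqrt (1 - 2 * m₀ * r₀ ^ ((2 : ℝ) - n)
            * Real.exp (-((n : ℝ) - 2) * t / ((n : ℝ) - 1)))) := by
  intro t ht htT
  obtain ⟨N, hNn⟩ : ∃ N : ℝ, (n : ℝ) = N + 1 := ⟨n - 1, by ring⟩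
  have hN : 0 < N := by
    have : (3 : ℝ) ≤ n := by exact_mod_cast hn
    linarith
  have e1 : (n : ℝ) - 1 = N := by linarith
  have e2 : (n : ℝ) - 2 = N - 1 := by linarith
  have hpow : r₀ ^ ((n : ℝ) - 2) * r₀ ^ ((2 : ℝ) - n) = 1 := by
    rw [← Real.rpow_add hr₀]
    simp
  have hk : 2 * m₀ * r₀ ^ ((2 : ℝ) - n) = 1 - r₀ ^ 2 * H₀ ^ 2 / N ^ 2 := by
    rw [hm₀, e1]
    linear_combination (1 - r₀ ^ 2 * H₀ ^ 2 / N ^ 2) * hpow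
  have hsub : ∀ u ∈ Set.Icc 0 t, (u : EReal) < T := fun u hu =>
    (EReal.coe_le_coe_iff.2 hu.2).trans_lt htT
  have hconst := eq_of_hasDerivWithinAt_zero_Icc ht fun u hu => by
    have hd := hvderiv u hu.1 (hsub u hu)
    rw [e1, e2, hNn] at hd
    exact hasDerivWithinAt_bernoulli_first_integral hN.ne' hr₀.ne'
      (hvpos u hu.1 (hsub u hu)).ne' (hd.mono fun x hx => ⟨hx.1, hsub x hx⟩)
  have hv := hvpos t ht htT
  rw [hk, e1, e2]
  have hE1 : Real.exp ((N + 1) * t / N)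
      = Real.exp (t / N) ^ 2 * Real.exp ((N - 1) * t / N) := by
    rw [sq, ← Real.exp_add, ← Real.exp_add]
    congr 1
    ring
  have hE2 : Real.exp (-(N - 1) * t / N) = (Real.exp ((N - 1) * t / N))⁻¹ := by
    rw [← Real.exp_neg]
    congr 1
    ring
  simp only [hv0, hE1, mul_zero, zero_div, Real.exp_zero, mul_one, inv_pow, inv_inv] at hconst
  rw [hE2]
  have ha := Real.exp_pos (t / N)
  have hb := Real.exp_pos ((N - 1) * t / N)
  generalize Real.exp (t / N) = a at *
  generalize Real.exp ((N - 1) * t / N) = b at *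
  have hD : 1 - (1 - r₀ ^ 2 * H₀ ^ 2 / N ^ 2) * b⁻¹ = (r₀ * a / (N * v t)) ^ 2 := by
    field_simp at hconst ⊢
    linear_combination -hconst
  rw [hD, Real.sqrt_sq (by positivity)]
  field_simp
end

section
/- Let n ≥ 3 be an integer, let (X, 𝒜, μ) be a measure space with 0 < μ(X) < ∞, let w > 0 be a real number, and let V, H : X → ℝ be measurable functions with V ≥ 0 and H ≥ 0, such that V^(2(n−1)/(n−2)) is μ-integrable and H² is μ-integrable. If ( (∫ V^(2(n−1)/(n−2)) dμ) / w )^((n−2)/(n−1)) ≤ (1/((n−1)·w)) · ∫ V·H dμ, then ( μ(X)/w )^(−1/(n−1)) · ∫ V·H dμ ≤ (1/(n−1)) · ∫ H² dμ. -/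
open MeasureTheory

/-- Cauchy–Schwarz inequality for integrals of nonnegative real functions. -/
theorem sq_integral_mul_le_of_nonneg {X : Type*} [MeasurableSpace X] {μ : Measure X}
    {f g : X → ℝ} (hf0 : ∀ x, 0 ≤ f x) (hg0 : ∀ x, 0 ≤ g x) (hf : MemLp f 2 μ)
    (hg : MemLp g 2 μ) :
    (∫ x, f x * g x ∂μ) ^ 2 ≤ (∫ x, f x ^ 2 ∂μ) * ∫ x, g x ^ 2 ∂μ := by
  have h := integral_mul_le_Lp_mul_Lq_of_nonneg (μ := μ) Real.HolderConjugate.two_two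
    (Filter.Eventually.of_forall hf0) (Filter.Eventually.of_forall hg0)
    (by simpa using hf) (by simpa using hg)
  simp only [Real.rpow_two, ← Real.sqrt_eq_rpow] at h
  have h0 : 0 ≤ ∫ x, f x * g x ∂μ := integral_nonneg fun x => mul_nonneg (hf0 x) (hg0 x)
  have hB : 0 ≤ ∫ x, f x ^ 2 ∂μ := integral_nonneg fun x => sq_nonneg _
  have hD : 0 ≤ ∫ x, g x ^ 2 ∂μ := integral_nonneg fun x => sq_nonneg _
  calc (∫ x, f x * g x ∂μ) ^ 2
      ≤ (√(∫ x, f x ^ 2 ∂μ) * √(∫ x, g x ^ 2 ∂μ)) ^ 2 := by gcongr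
    _ = _ := by rw [mul_pow, Real.sq_sqrt hB, Real.sq_sqrt hD]

/-- A nonnegative measurable `f` with `f ^ p` integrable lies in `L^p`. -/
theorem memLp_ofReal_of_integrable_rpow {X : Type*} [MeasurableSpace X] {μ : Measure X}
    {f : X → ℝ} {p : ℝ} (hp : 0 < p) (hfm : Measurable f) (hf0 : ∀ x, 0 ≤ f x)
    (hf : Integrable (fun x => f x ^ p) μ) : MemLp f (ENNReal.ofReal p) μ := by
  rw [← integrable_norm_rpow_iff hfm.aestronglyMeasurable (by simpa using hp)
    ENNReal.ofReal_ne_top, ENNReal.toReal_ofReal hp.le]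
  simpa only [Real.norm_of_nonneg (hf0 _)] using hf

/-- Hölder's inequality against the constant function `1` on a finite measure space. -/
theorem integral_le_rpow_integral_rpow_mul_measure {X : Type*} [MeasurableSpace X]
    {μ : Measure X} [IsFiniteMeasure μ] {f : X → ℝ} {p q : ℝ} (hpq : p.HolderConjugate q)
    (hf0 : ∀ x, 0 ≤ f x) (hf : MemLp f (ENNReal.ofReal p) μ) :
    ∫ x, f x ∂μ ≤ (∫ x, f x ^ p ∂μ) ^ (1 / p) * (μ Set.univ).toReal ^ (1 / q) := by
  simpa [Measure.real] using integral_mul_le_Lp_mul_Lq_of_nonneg (g := fun _ => (1 : ℝ)) hpq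
    (Filter.Eventually.of_forall hf0) (Filter.Eventually.of_forall fun _ => zero_le_one) hf
    (memLp_const 1)

/-- Analytic core of the Hawking mass comparison: if the conformal Minkowski
inequality `((∫ V^(2(n−1)/(n−2)))/w)^((n−2)/(n−1)) ≤ (1/((n−1)w)) ∫ V·H` holds on a
finite measure space, then `(μ(X)/w)^(−1/(n−1)) ∫ V·H ≤ (1/(n−1)) ∫ H²`. -/
theorem hawking_mass_comparison_core
    {X : Type*} [MeasurableSpace X] (μ : Measure X)
    (n : ℕ) (hn : 3 ≤ n)
    (hμ0 : 0 < μ Set.univ) (hμtop : μ Set.univ < ⊤)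
    (w : ℝ) (hw : 0 < w)
    (V H : X → ℝ) (hVmeas : Measurable V) (hHmeas : Measurable H)
    (hVnonneg : ∀ x, 0 ≤ V x) (hHnonneg : ∀ x, 0 ≤ H x)
    (hVint : Integrable (fun x => V x ^ (2 * ((n : ℝ) - 1) / ((n : ℝ) - 2))) μ)
    (hHint : Integrable (fun x => H x ^ 2) μ)
    (hMink : ((∫ x, V x ^ (2 * ((n : ℝ) - 1) / ((n : ℝ) - 2)) ∂μ) / w)
        ^ (((n : ℝ) - 2) / ((n : ℝ) - 1))
      ≤ 1 / (((n : ℝ) - 1) * w) * ∫ x, V x * H x ∂μ) :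
    ((μ Set.univ).toReal / w) ^ (-(1 : ℝ) / ((n : ℝ) - 1)) * ∫ x, V x * H x ∂μ
      ≤ 1 / ((n : ℝ) - 1) * ∫ x, H x ^ 2 ∂μ := by
  have : IsFiniteMeasure μ := ⟨hμtop⟩
  have hn' : (3 : ℝ) ≤ n := by exact_mod_cast hn
  have h1 : (0 : ℝ) < n - 1 := by linarith
  have h2 : (0 : ℝ) < n - 2 := by linarith
  have hM : 0 < (μ Set.univ).toReal := ENNReal.toReal_pos hμ0.ne' hμtop.ne
  have hconj : (((n : ℝ) - 1) / (n - 2)).HolderConjugate ((n : ℝ) - 1) := by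
    rw [Real.holderConjugate_iff]
    refine ⟨by rw [lt_div_iff₀ h2]; linarith, ?_⟩
    field_simp
    ring
  have hpow : ∀ x, (V x ^ 2) ^ (((n : ℝ) - 1) / (n - 2))
      = V x ^ (2 * ((n : ℝ) - 1) / ((n : ℝ) - 2)) := fun x => by
    rw [← Real.rpow_natCast_mul (hVnonneg x), mul_div_assoc, Nat.cast_ofNat]
  have hV2 : MemLp (fun x => V x ^ 2) (ENNReal.ofReal (((n : ℝ) - 1) / (n - 2))) μ :=
    memLp_ofReal_of_integrable_rpow hconj.pos (hVmeas.pow_const 2) (fun x => sq_nonneg _)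
      (by simpa only [hpow] using hVint)
  have hVL2 : MemLp V 2 μ := by
    rw [memLp_two_iff_integrable_sq hVmeas.aestronglyMeasurable]
    exact hV2.integrable (by simpa using hconj.lt.le)
  have hHL2 : MemLp H 2 μ :=
    (memLp_two_iff_integrable_sq hHmeas.aestronglyMeasurable).2 hHint
  have hCS := sq_integral_mul_le_of_nonneg hVnonneg hHnonneg hVL2 hHL2
  have hHol := integral_le_rpow_integral_rpow_mul_measure hconj (fun x => sq_nonneg (V x)) hV2
  simp only [hpow, one_div_div] at hHol
  have hA : 0 ≤ ∫ x, V x ^ (2 * ((n : ℝ) - 1) / ((n : ℝ) - 2)) ∂μ :=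
    integral_nonneg fun x => Real.rpow_nonneg (hVnonneg x) _
  have hC : 0 ≤ ∫ x, V x * H x ∂μ :=
    integral_nonneg fun x => mul_nonneg (hVnonneg x) (hHnonneg x)
  have hD : 0 ≤ ∫ x, H x ^ 2 ∂μ := integral_nonneg fun x => sq_nonneg _
  generalize (∫ x, V x ^ (2 * ((n : ℝ) - 1) / ((n : ℝ) - 2)) ∂μ) = A at *
  generalize (∫ x, V x * H x ∂μ) = C at *
  generalize (∫ x, H x ^ 2 ∂μ) = D at *
  generalize (∫ x, V x ^ 2 ∂μ) = B at *
  generalize (μ Set.univ).toReal = M at *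
  have hK : 0 < (M / w) ^ (1 / ((n : ℝ) - 1)) := by positivity
  have hsplit : A ^ (((n : ℝ) - 2) / (n - 1)) * M ^ (1 / ((n : ℝ) - 1))
      = (A / w) ^ (((n : ℝ) - 2) / (n - 1)) * (w * (M / w) ^ (1 / ((n : ℝ) - 1))) := by
    have hw1 : w ^ (((n : ℝ) - 2) / (n - 1)) * w ^ (1 / ((n : ℝ) - 1)) = w := by
      rw [← Real.rpow_add hw, ← add_div, show (n : ℝ) - 2 + 1 = n - 1 by ring,
        div_self h1.ne', Real.rpow_one]
    rw [Real.div_rpow hA hw.le, Real.div_rpow hM.le hw.le]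
    have hx := Real.rpow_pos_of_pos hw (((n : ℝ) - 2) / (n - 1))
    have hy := Real.rpow_pos_of_pos hw (1 / ((n : ℝ) - 1))
    generalize w ^ (((n : ℝ) - 2) / (n - 1)) = x at *
    generalize w ^ (1 / ((n : ℝ) - 1)) = y at *
    rw [← hw1]
    field_simp
  rw [neg_div, Real.rpow_neg (by positivity)]
  generalize (M / w) ^ (1 / ((n : ℝ) - 1)) = K at *
  have hB : B ≤ K * C / (n - 1) := by
    calc B ≤ _ := hHol
      _ = _ := hsplit
      _ ≤ 1 / (((n : ℝ) - 1) * w) * C * (w * K) := by gcongr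
      _ = K * C / (n - 1) := by field_simp
  rw [inv_mul_le_iff₀ hK]
  rcases hC.eq_or_lt with rfl | hC
  · positivity
  · refine le_of_mul_le_mul_right ?_ hC
    calc C * C = C ^ 2 := (sq C).symm
      _ ≤ B * D := hCS
      _ ≤ K * C / (n - 1) * D := by gcongr
      _ = K * (1 / (n - 1) * D) * C := by ring
end

section
/- Let n ≥ 3 be an integer, let (X, 𝒜, μ) be a measure space with 0 < μ(X) < ∞, let w > 0 be a real number, and let V, H : X → ℝ be measurable functions with V ≥ 0 and H ≥ 0, such that V^(2(n−1)/(n−2)) is μ-integrable with ∫ V^(2(n−1)/(n−2)) dμ > 0 and H² is μ-integrable. Suppose that ( (∫ V^(2(n−1)/(n−2)) dμ) / w )^((n−2)/(n−1)) ≤ (1/((n−1)·w)) · ∫ V·H dμ, and suppose that equality holds in the derived comparison, i.e. ( μ(X)/w )^(−1/(n−1)) · ∫ V·H dμ = (1/(n−1)) · ∫ H² dμ. Then there exist constants V₀ > 0 and H₀ > 0 such that V = V₀ μ-almost everywhere, H = H₀ μ-almost everywhere, and V₀ = (1/(n−1)) · ( μ(X)/w )^(1/(n−1)) · H₀. -/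
open MeasureTheory

/-- On a finite measure space, `f ^ θ` is integrable for integrable `f ≥ 0` and `0 < θ < 1`. -/
theorem MeasureTheory.Integrable.rpow_of_lt_one {X : Type*} [MeasurableSpace X] {μ : Measure X}
    [IsFiniteMeasure μ] {θ : ℝ} (h0 : 0 < θ) (h1 : θ < 1) {f : X → ℝ} (hf : Integrable f μ)
    (hf0 : ∀ x, 0 ≤ f x) : Integrable (fun x => f x ^ θ) μ := by
  refine ((integrable_const (1 : ℝ)).add hf).mono'
    (hf.aestronglyMeasurable.aemeasurable.pow_const θ).aestronglyMeasurable
    (Filter.Eventually.of_forall fun x => ?_)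
  rw [Real.norm_of_nonneg (Real.rpow_nonneg (hf0 x) θ)]
  change f x ^ θ ≤ 1 + f x
  rcases le_total (f x) 1 with h | h
  · linarith [Real.rpow_le_one (hf0 x) h h0.le, hf0 x]
  · have := Real.rpow_le_rpow_of_exponent_le h h1.le
    rw [Real.rpow_one] at this
    linarith

/-- Jensen's inequality for `t ↦ t ^ θ`, `0 < θ < 1`: equality forces `f` to be constant. -/
theorem ae_eq_average_of_rpow_integral_le {X : Type*} [MeasurableSpace X] {μ : Measure X}
    [IsFiniteMeasure μ] [NeZero μ] {θ : ℝ} (h0 : 0 < θ) (h1 : θ < 1) {f : X → ℝ}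
    (hf : Integrable f μ) (hf0 : ∀ x, 0 ≤ f x)
    (h : (∫ x, f x ∂μ) ^ θ * μ.real Set.univ ^ (1 - θ) ≤ ∫ x, f x ^ θ ∂μ) :
    f =ᵐ[μ] Function.const X (⨍ x, f x ∂μ) := by
  refine ((Real.strictConcaveOn_rpow h0 h1).ae_eq_const_or_lt_map_average
    (Real.continuous_rpow_const h0.le).continuousOn isClosed_Ici
    (Filter.Eventually.of_forall hf0) hf (hf.rpow_of_lt_one h0 h1 hf0)).resolve_right ?_
  have hM : 0 < μ.real Set.univ := measureReal_univ_pos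
  rw [not_lt, average_eq, average_eq, smul_eq_mul, smul_eq_mul,
    Real.mul_rpow (inv_nonneg.2 hM.le) (integral_nonneg hf0), Real.inv_rpow hM.le]
  rw [Real.rpow_sub hM, Real.rpow_one] at h
  calc (μ.real Set.univ ^ θ)⁻¹ * (∫ x, f x ∂μ) ^ θ
      = (μ.real Set.univ)⁻¹ *
          ((∫ x, f x ∂μ) ^ θ * (μ.real Set.univ / μ.real Set.univ ^ θ)) := by field_simp
    _ ≤ _ := by gcongr

/-- Rigidity in the Hawking mass comparison: if the conformal Minkowski inequality
holds and equality holds in the derived comparison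
`(μ(X)/w)^(−1/(n−1)) ∫ V·H = (1/(n−1)) ∫ H²`, then `V` and `H` are almost
everywhere equal to positive constants `V₀`, `H₀` with
`V₀ = (1/(n−1)) (μ(X)/w)^(1/(n−1)) H₀`. -/
theorem hawking_mass_comparison_rigidity
    {X : Type*} [MeasurableSpace X] (μ : Measure X)
    (n : ℕ) (hn : 3 ≤ n)
    (hμ0 : 0 < μ Set.univ) (hμtop : μ Set.univ < ⊤)
    (w : ℝ) (hw : 0 < w)
    (V H : X → ℝ) (hVmeas : Measurable V) (hHmeas : Measurable H)
    (hVnonneg : ∀ x, 0 ≤ V x) (hHnonneg : ∀ x, 0 ≤ H x)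
    (hVint : Integrable (fun x => V x ^ (2 * ((n : ℝ) - 1) / ((n : ℝ) - 2))) μ)
    (hVpos : 0 < ∫ x, V x ^ (2 * ((n : ℝ) - 1) / ((n : ℝ) - 2)) ∂μ)
    (hHint : Integrable (fun x => H x ^ 2) μ)
    (hMink : ((∫ x, V x ^ (2 * ((n : ℝ) - 1) / ((n : ℝ) - 2)) ∂μ) / w)
        ^ (((n : ℝ) - 2) / ((n : ℝ) - 1))
      ≤ 1 / (((n : ℝ) - 1) * w) * ∫ x, V x * H x ∂μ)
    (hEq : ((μ Set.univ).toReal / w) ^ (-(1 : ℝ) / ((n : ℝ) - 1)) * ∫ x, V x * H x ∂μ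
      = 1 / ((n : ℝ) - 1) * ∫ x, H x ^ 2 ∂μ) :
    ∃ V₀ H₀ : ℝ, 0 < V₀ ∧ 0 < H₀ ∧
      (∀ᵐ x ∂μ, V x = V₀) ∧ (∀ᵐ x ∂μ, H x = H₀) ∧
      V₀ = 1 / ((n : ℝ) - 1) * ((μ Set.univ).toReal / w) ^ ((1 : ℝ) / ((n : ℝ) - 1)) * H₀ := by
  have : IsFiniteMeasure μ := ⟨hμtop⟩
  have : NeZero μ := ⟨fun h => by simp [h] at hμ0⟩
  have hn' : (3 : ℝ) ≤ n := by exact_mod_cast hn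
  have hm : 0 < (n : ℝ) - 1 := by linarith
  have hm2 : 0 < (n : ℝ) - 2 := by linarith
  have hM : 0 < (μ Set.univ).toReal := ENNReal.toReal_pos hμ0.ne' hμtop.ne
  set q : ℝ := 2 * ((n : ℝ) - 1) / ((n : ℝ) - 2) with hq
  set θ : ℝ := ((n : ℝ) - 2) / ((n : ℝ) - 1) with hθ
  have hq0 : 0 < q := by positivity
  have hθ0 : 0 < θ := by positivity
  have hθ1 : θ < 1 := by rw [hθ, div_lt_one hm]; linarith
  have hqθ : q * θ = 2 := by rw [hq, hθ]; field_simp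
  have hθm : 1 / ((n : ℝ) - 1) = 1 - θ := by rw [hθ]; field_simp; ring
  have hVq0 : ∀ x, 0 ≤ V x ^ q := fun x => Real.rpow_nonneg (hVnonneg x) q
  have hVqθ : ∀ x, (V x ^ q) ^ θ = V x ^ 2 := fun x => by
    rw [← Real.rpow_mul (hVnonneg x), hqθ, Real.rpow_two]
  have hV2 : Integrable (fun x => V x ^ 2) μ := by
    simpa only [hVqθ] using hVint.rpow_of_lt_one hθ0 hθ1 hVq0
  have hVH : Integrable (fun x => V x * H x) μ := MemLp.integrable_mul
    ((memLp_two_iff_integrable_sq hVmeas.aestronglyMeasurable).2 hV2)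
    ((memLp_two_iff_integrable_sq hHmeas.aestronglyMeasurable).2 hHint)
  set M := (μ Set.univ).toReal with hMdef
  set k : ℝ := (M / w) ^ ((1 : ℝ) / ((n : ℝ) - 1)) with hk
  have hk0 : 0 < k := by positivity
  set c : ℝ := 1 / ((n : ℝ) - 1) * k with hc
  have hc0 : 0 < c := by positivity
  -- In terms of `c`, the equality hypothesis reads `∫ V H = c ∫ H²`.
  have hC : ∫ x, V x * H x ∂μ = c * ∫ x, H x ^ 2 ∂μ := by
    rw [neg_div, Real.rpow_neg (by positivity), ← hk] at hEq
    rw [hc, mul_right_comm, ← hEq]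
    field_simp
  have hHolder : (∫ x, V x ^ q ∂μ) ^ θ * M ^ (1 - θ) ≤ c * ∫ x, V x * H x ∂μ := by
    rw [Real.div_rpow hVpos.le hw.le, div_le_iff₀ (by positivity)] at hMink
    have hkw : w ^ θ * M ^ (1 - θ) = k * w := by
      rw [hk, hθm, Real.div_rpow hM.le hw.le, Real.rpow_sub hw, Real.rpow_one]
      field_simp
    calc _ ≤ 1 / (((n : ℝ) - 1) * w) * (∫ x, V x * H x ∂μ) * w ^ θ * M ^ (1 - θ) := by gcongr
      _ = 1 / (((n : ℝ) - 1) * w) * (∫ x, V x * H x ∂μ) * (k * w) := by rw [← hkw]; ring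
      _ = _ := by rw [hc]; field_simp
  have hsq : ∫ x, (V x - c * H x) ^ 2 ∂μ = ∫ x, V x ^ 2 ∂μ - c * ∫ x, V x * H x ∂μ := by
    have h : ∀ x, (V x - c * H x) ^ 2 = V x ^ 2 - 2 * c * (V x * H x) + c ^ 2 * H x ^ 2 :=
      fun x => by ring
    simp only [h]
    rw [integral_add (f := fun x => V x ^ 2 - 2 * c * (V x * H x))
        (hV2.sub (hVH.const_mul _)) (hHint.const_mul _), integral_sub hV2 (hVH.const_mul _), integral_const_mul, integral_const_mul, hC]
    ring
  have hsq0 : 0 ≤ ∫ x, (V x - c * H x) ^ 2 ∂μ := integral_nonneg fun x => sq_nonneg _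
  set s := ⨍ x, V x ^ q ∂μ with hs
  have hs0 : 0 < s := by
    rw [hs, average_eq, smul_eq_mul]
    exact mul_pos (inv_pos.2 hM) hVpos
  have hVs : (fun x => V x ^ q) =ᵐ[μ] Function.const X s := by
    refine ae_eq_average_of_rpow_integral_le hθ0 hθ1 hVint hVq0 ?_
    simp only [hVqθ]
    exact hHolder.trans (by linarith)
  have hV : ∀ᵐ x ∂μ, V x = s ^ q⁻¹ := by
    filter_upwards [hVs] with x hx
    rw [← Real.rpow_rpow_inv (hVnonneg x) hq0.ne', hx, Function.const_apply]
  have hVV : ∫ x, V x ^ 2 ∂μ = (∫ x, V x ^ q ∂μ) ^ θ * M ^ (1 - θ) := by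
    have h1 : ∫ x, V x ^ q ∂μ = M * s := by
      rw [hs, average_eq, smul_eq_mul]
      exact (mul_inv_cancel_left₀ hM.ne' _).symm
    have h2 : ∫ x, V x ^ 2 ∂μ = M * s ^ θ := by
      rw [integral_congr_ae (g := fun _ => s ^ θ), integral_const, smul_eq_mul]
      · rfl
      · filter_upwards [hVs] with x hx
        rw [← hVqθ, hx, Function.const_apply]
    rw [h1, h2, Real.mul_rpow hM.le hs0.le, Real.rpow_sub hM, Real.rpow_one]
    field_simp
  have hVcH : ∀ᵐ x ∂μ, V x = c * H x := by
    have hint : Integrable (fun x => (V x - c * H x) ^ 2) μ :=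
      (((memLp_two_iff_integrable_sq hVmeas.aestronglyMeasurable).2 hV2).sub
        (((memLp_two_iff_integrable_sq hHmeas.aestronglyMeasurable).2 hHint).const_mul
          c)).integrable_sq
    have h := (integral_eq_zero_iff_of_nonneg (fun x => sq_nonneg (V x - c * H x)) hint).1
      (by linarith)
    filter_upwards [h] with x hx
    exact sub_eq_zero.1 (pow_eq_zero_iff two_ne_zero |>.1 hx)
  refine ⟨s ^ q⁻¹, s ^ q⁻¹ / c, by positivity, by positivity, hV, ?_, by field_simp⟩
  filter_upwards [hV, hVcH] with x h1 h2
  rw [← h1, h2]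
  field_simp
end

section
/- Let E be a real normed vector space, let s ⊆ E be an open preconnected set, let f : E → ℝ be differentiable at every point of s, and let c ∈ ℝ. If for every x ∈ s one has (c − f(x)) · (Df)(x) = 0 (where (Df)(x) denotes the Fréchet derivative of f at x, a continuous linear map E → ℝ), then f is constant on s; in particular (Df)(x) = 0 for every x ∈ s. -/
/-- Differentiation lemma: if `f` is differentiable on an open preconnected set `s`
and `(c − f(x)) · Df(x) = 0` for every `x ∈ s`, then `f` is constant on `s`;
in particular `Df(x) = 0` for every `x ∈ s`. -/
theorem constant_of_smul_fderiv_eq_zero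
    {E : Type*} [NormedAddCommGroup E] [NormedSpace ℝ E]
    (s : Set E) (hs : IsOpen s) (hsc : IsPreconnected s)
    (f : E → ℝ) (hf : ∀ x ∈ s, DifferentiableAt ℝ f x) (c : ℝ)
    (h : ∀ x ∈ s, (c - f x) • fderiv ℝ f x = 0) :
    (∀ x ∈ s, ∀ y ∈ s, f x = f y) ∧ (∀ x ∈ s, fderiv ℝ f x = 0) := by
  have hsq : ∀ x ∈ s, HasFDerivAt (fun y => (c - f y) ^ 2) (0 : E →L[ℝ] ℝ) x := by
    intro x hx
    refine (((hf x hx).hasFDerivAt.const_sub c).pow 2).congr_fderiv ?_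
    ext v
    have hv : (c - f x) * fderiv ℝ f x v = 0 := by
      simpa using congrArg (fun L : E →L[ℝ] ℝ => L v) (h x hx)
    simp [mul_assoc, mul_eq_zero.mp hv]
  have hconst : ∀ x ∈ s, ∀ y ∈ s, (c - f x) ^ 2 = (c - f y) ^ 2 := fun x hx y hy =>
    hs.is_const_of_fderiv_eq_zero hsc
      (fun z hz => (hsq z hz).differentiableAt.differentiableWithinAt)
      (fun z hz => (hsq z hz).fderiv) hx hy
  have hzero : ∀ x ∈ s, fderiv ℝ f x = 0 := by
    intro x hx
    rcases smul_eq_zero.mp (h x hx) with hc | hd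
    · have hloc : f =ᶠ[nhds x] fun _ => c := by
        filter_upwards [hs.mem_nhds hx] with y hy
        have hy0 : (c - f y) ^ 2 = 0 := by rw [hconst y hy x hx, hc, zero_pow two_ne_zero]
        exact (sub_eq_zero.mp (pow_eq_zero_iff two_ne_zero |>.mp hy0)).symm
      rw [hloc.fderiv_eq, fderiv_fun_const, Pi.zero_apply]
    · exact hd
  exact ⟨fun x hx y hy => hs.is_const_of_fderiv_eq_zero hsc
    (fun z hz => (hf z hz).differentiableWithinAt) hzero hx hy, hzero⟩
end
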